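/- Fix integers n ≥ 1 and j ≥ 1 and a real number λ. Then the sum over all j-balanced set partitions π of {1,…,n} × {1,…,j} of the weight (λ/j)^{#π} · ∏_{b ∈ π} (#b/j)^{j−1} · ((#b/j − 1)!)^j equals (λ/j)^{↑n} · (n!)^{j−1}. (This is the normalization of the limiting distribution p_n^j(π;λ) = (λ/j)^{#π} ∏_{b∈π} (#b/j)^{j−1} Γ(#b/j)^j / [(λ/j)^{↑n}(n!)^{j−1}], obtained from the balanced Chinese restaurant process when seating is done according to the one-parameter CRP with parameter λ.) -/

import Mathlib

/-- The rising factorial `x^{↑n} = x(x+1)⋯(x+n−1)`. -/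
def risingFactorial (x : ℝ) (n : ℕ) : ℝ := ∏ i ∈ Finset.range n, (x + i)

/-- A set partition of `{1,…,n} × {1,…,j}` is `j`-balanced if every block contains an
equal number of elements of each of the `j` types (the type of an element being its
second coordinate). -/
def IsBalanced {n j : ℕ} (π : Finpartition (Finset.univ : Finset (Fin n × Fin j))) : Prop :=
  ∀ b ∈ π.parts, ∀ t t' : Fin j,
    (b.filter fun p => p.2 = t).card = (b.filter fun p => p.2 = t').card

instance {n j : ℕ} (π : Finpartition (Finset.univ : Finset (Fin n × Fin j))) :
    Decidable (IsBalanced π) := by unfold IsBalanced; infer_instance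

section BalancedEwens

open Finset

/-- Sums of multiplicative weights over the partitions of `s` decompose according to the part
containing a given element `a ∈ s`. -/
theorem sum_finpartition_prod_eq {β R : Type*} [DecidableEq β] [CommSemiring R]
    (w : Finset β → R) {s : Finset β} {a : β} (ha : a ∈ s) :
    ∑ π : Finpartition s, ∏ b ∈ π.parts, w b =
      ∑ b ∈ s.powerset with a ∈ b, w b * ∑ π : Finpartition (s \ b), ∏ b' ∈ π.parts, w b' := by
  rw [← sum_fiberwise_of_maps_to (s := univ) (t := {b ∈ s.powerset | a ∈ b})
    (g := fun π : Finpartition s => π.part a) (by simp [ha])]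
  refine sum_congr rfl fun b hb => ?_
  obtain ⟨hbs, hab⟩ : b ⊆ s ∧ a ∈ b := by simpa using hb
  have hb0 : b ≠ ⊥ := ne_empty_of_mem hab
  have hdisj : Disjoint (s \ b) b := sdiff_disjoint
  have hunion : s \ b ⊔ b = s := sdiff_union_of_subset hbs
  have hnot (π : Finpartition (s \ b)) : b ∉ π.parts := fun h =>
    (mem_sdiff.1 (π.le h hab)).2 hab
  rw [mul_sum]
  symm
  refine sum_bij (fun π _ => π.extend hb0 hdisj hunion) ?_ ?_ ?_ ?_
  · intro π _
    simp only [mem_filter, mem_univ, true_and]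
    exact Finpartition.part_eq_of_mem _ (mem_insert_self _ _) hab
  · intro π _ ρ _ h
    have h' : insert b π.parts = insert b ρ.parts := congrArg Finpartition.parts h
    ext1
    rw [← erase_insert (hnot π), h', erase_insert (hnot ρ)]
  · intro ρ hρ
    obtain rfl : ρ.part a = b := by simpa using hρ
    have hmem : ρ.part a ∈ ρ.parts := ρ.part_mem.2 ha
    refine ⟨⟨ρ.parts.erase (ρ.part a), ρ.supIndep.subset (erase_subset _ _), ?_, ?_⟩,
      mem_univ _, ?_⟩
    · ext x
      simp only [mem_sup, mem_erase, id, mem_sdiff]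
      constructor
      · rintro ⟨v, ⟨hv, hvρ⟩, hx⟩
        exact ⟨ρ.le hvρ hx, fun hx' => hv (ρ.eq_of_mem_parts hvρ hmem hx hx')⟩
      · rintro ⟨hx, hx'⟩
        obtain ⟨v, hv, hxv⟩ := ρ.exists_mem hx
        exact ⟨v, ⟨fun h => hx' (h ▸ hxv), hv⟩, hxv⟩
    · exact fun h => ρ.bot_notMem (mem_of_mem_erase h)
    · ext1
      exact insert_erase hmem
  · intro π _
    exact (prod_insert (hnot π)).symm

theorem risingFactorial_succ (x : ℝ) (n : ℕ) :
    risingFactorial x (n + 1) = risingFactorial x n * (x + n) :=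
  prod_range_succ _ _

theorem mul_sum_descFactorial_mul_risingFactorial (x : ℝ) (n : ℕ) :
    x * ∑ m ∈ range (n + 1), (n.descFactorial m : ℝ) * risingFactorial x (n - m) =
      risingFactorial x (n + 1) := by
  induction n with
  | zero => simp [risingFactorial]
  | succ n ih =>
    rw [sum_range_succ', mul_add, risingFactorial_succ x (n + 1), ← ih]
    simp only [Nat.succ_descFactorial_succ, Nat.add_sub_add_right, Nat.cast_mul, mul_assoc,
      ← mul_sum, Nat.descFactorial_zero, Nat.sub_zero, ← ih]
    push_cast
    ring

section Colored

variable {β ι : Type*} [Fintype ι] [DecidableEq ι] (c : β → ι)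

/-- The Ewens weight of a block `b` of a `c`-coloured set: zero unless all colours occur equally
often in `b`. -/
noncomputable def balancedEwensWeight (x : ℝ) (b : Finset β) : ℝ :=
  if ∀ t t', #{p ∈ b | c p = t} = #{p ∈ b | c p = t'} then
    x * (((#b / Fintype.card ι : ℕ) : ℝ) ^ (Fintype.card ι - 1) *
      ((#b / Fintype.card ι - 1).factorial : ℝ) ^ Fintype.card ι)
  else 0

theorem card_eq_mul_of_forall_card_filter_eq {b : Finset β} {m : ℕ}
    (hb : ∀ t, #{p ∈ b | c p = t} = m) : #b = m * Fintype.card ι := by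
  rw [card_eq_sum_card_fiberwise (f := c) (t := univ) (by simp)]
  simp [hb, mul_comm]

theorem balancedEwensWeight_of_forall_card_filter_eq [Nonempty ι] (x : ℝ) {b : Finset β} {m : ℕ}
    (hb : ∀ t, #{p ∈ b | c p = t} = m) :
    balancedEwensWeight c x b =
      x * ((m : ℝ) ^ (Fintype.card ι - 1) * ((m - 1).factorial : ℝ) ^ Fintype.card ι) := by
  rw [balancedEwensWeight, if_pos fun t t' => (hb t).trans (hb t').symm,
    card_eq_mul_of_forall_card_filter_eq c hb, Nat.mul_div_cancel _ Fintype.card_pos]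

variable [DecidableEq β]

theorem card_filter_forall_card_filter_eq {s : Finset β} {k : ℕ}
    (hs : ∀ t, #{p ∈ s | c p = t} = k + 1) {a : β} (ha : a ∈ s) (m : ℕ) :
    #{b ∈ s.powerset | a ∈ b ∧ ∀ t, #{p ∈ b | c p = t} = m + 1} =
      k.choose m * (k + 1).choose (m + 1) ^ (Fintype.card ι - 1) := by
  let A : ι → Finset β := fun t => if t = c a then {a} else ∅
  have hA (t : ι) : A t ⊆ {p ∈ s | c p = t} ∧ #(A t) ≤ m + 1 := by
    by_cases h : t = c a <;> simp [A, h, ha]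
  have hfiber {f : ι → Finset β} (hf : f ∈ Fintype.piFinset fun t =>
      {v ∈ powersetCard (m + 1) {p ∈ s | c p = t} | A t ⊆ v}) (t : ι) :
      {p ∈ univ.biUnion f | c p = t} = f t := by
    simp only [Fintype.mem_piFinset, mem_filter, mem_powersetCard] at hf
    ext p
    simp only [mem_filter, mem_biUnion, mem_univ, true_and]
    constructor
    · rintro ⟨⟨t', hp⟩, h⟩
      have := (mem_filter.1 ((hf t').1.1 hp)).2
      rwa [← h, this]
    · intro hp
      exact ⟨⟨t, hp⟩, (mem_filter.1 ((hf t).1.1 hp)).2⟩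
  trans #(Fintype.piFinset fun t =>
    {v ∈ powersetCard (m + 1) {p ∈ s | c p = t} | A t ⊆ v})
  · refine card_bij' (fun b _ t => {p ∈ b | c p = t}) (fun f _ => univ.biUnion f) ?_ ?_ ?_ ?_
    · intro b hb
      simp only [mem_filter, mem_powerset] at hb
      obtain ⟨hbs, hab, hb⟩ := hb
      simp only [Fintype.mem_piFinset, mem_filter, mem_powersetCard, hb, and_true]
      intro t
      refine ⟨filter_subset_filter _ hbs, ?_⟩
      by_cases h : t = c a <;> simp [A, h, hab]
    · intro f hf
      have hfil := hfiber hf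
      simp only [Fintype.mem_piFinset, mem_filter, mem_powersetCard] at hf
      simp only [mem_filter, mem_powerset, hfil, mem_biUnion, mem_univ, true_and]
      refine ⟨biUnion_subset.2 fun t _ => (hf t).1.1.trans (filter_subset _ _),
        ⟨c a, (hf (c a)).2 (by simp [A])⟩, fun t => (hf t).1.2⟩
    · intro b _
      ext p
      simp
    · exact fun f hf => funext (hfiber hf)
  · rw [Fintype.card_piFinset]
    simp_rw [card_filter_powersetCard_subset _ _ _ (hA _).1 (hA _).2, hs]
    rw [← mul_prod_erase univ _ (mem_univ (c a)),
      prod_congr rfl (g := fun _ => (k + 1).choose (m + 1)) fun t ht => by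
        simp [A, ne_of_mem_erase ht]]
    simp [A, card_erase_of_mem]

theorem sum_prod_balancedEwensWeight [Nonempty ι] (x : ℝ) (k : ℕ) :
    ∀ s : Finset β, (∀ t, #{p ∈ s | c p = t} = k) →
      ∑ π : Finpartition s, ∏ b ∈ π.parts, balancedEwensWeight c x b =
        risingFactorial x k * (k.factorial : ℝ) ^ (Fintype.card ι - 1) := by
  induction k using Nat.strong_induction_on with
  | _ k ih =>
  intro s hs
  obtain ⟨J, hJ⟩ : ∃ J, Fintype.card ι = J + 1 :=
    ⟨_, (Nat.succ_pred_eq_of_pos Fintype.card_pos).symm⟩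
  rcases k with _ | k
  · obtain rfl : s = ∅ := by
      rw [← card_eq_zero, card_eq_mul_of_forall_card_filter_eq c hs, zero_mul]
    have hparts (π : Finpartition (∅ : Finset β)) : π.parts = ∅ := π.parts_eq_empty_iff.2 rfl
    have : Fintype.card (Finpartition (∅ : Finset β)) = 1 :=
      Fintype.card_eq_one_iff.2 ⟨Finpartition.empty _, fun π => by
        ext1; rw [hparts, hparts]⟩
    simp [hparts, this, risingFactorial]
  obtain ⟨a, ha⟩ : s.Nonempty := by
    rw [← card_pos, card_eq_mul_of_forall_card_filter_eq c hs]
    exact Nat.mul_pos k.succ_pos Fintype.card_pos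
  have hpos {b : Finset β} (hab : a ∈ b) : 0 < #{p ∈ b | c p = c a} :=
    card_pos.2 ⟨a, by simp [hab]⟩
  rw [sum_finpartition_prod_eq _ ha, ← sum_fiberwise_of_maps_to (t := range (k + 1))
    (g := fun b => #{p ∈ b | c p = c a} - 1), ← mul_sum_descFactorial_mul_risingFactorial,
    mul_sum, sum_mul]
  · refine sum_congr rfl fun m hm => ?_
    have hmk : m ≤ k := Nat.lt_succ_iff.1 (mem_range.1 hm)
    have hsub : {b ∈ s.powerset | a ∈ b ∧ ∀ t, #{p ∈ b | c p = t} = m + 1} ⊆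
        {b ∈ {b ∈ s.powerset | a ∈ b} | #{p ∈ b | c p = c a} - 1 = m} := by
      intro b hb
      simp only [mem_filter] at hb ⊢
      exact ⟨⟨hb.1, hb.2.1⟩, by rw [hb.2.2]; rfl⟩
    rw [← sum_subset hsub]
    · rw [sum_congr rfl (g := fun _ => x * (((m + 1 : ℕ) : ℝ) ^ (Fintype.card ι - 1) *
        (m.factorial : ℝ) ^ Fintype.card ι) *
          (risingFactorial x (k - m) * ((k - m).factorial : ℝ) ^ (Fintype.card ι - 1)))]
      · rw [sum_const, card_filter_forall_card_filter_eq c hs ha, hJ, nsmul_eq_mul]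
        have h1 : (k.choose m : ℝ) * m.factorial = k.descFactorial m := by
          rw [Nat.descFactorial_eq_factorial_mul_choose]
          push_cast
          ring
        have h2 : ((k + 1).choose (m + 1) : ℝ) * ((m + 1 : ℕ) * m.factorial) *
            (k - m).factorial = (k + 1).factorial := by
          rw [← Nat.choose_mul_factorial_mul_factorial (Nat.succ_le_succ hmk),
            Nat.factorial_succ m, Nat.succ_sub_succ]
          push_cast
          ring
        rw [← h1, ← h2]
        simp only [Nat.add_sub_cancel, Nat.cast_mul, Nat.cast_pow, mul_pow]
        ring
      · intro b hb
        simp only [mem_filter, mem_powerset] at hb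
        rw [balancedEwensWeight_of_forall_card_filter_eq c x hb.2.2, Nat.add_sub_cancel,
          ih (k - m) (by omega) (s \ b)]
        intro t
        rw [show ({p ∈ s \ b | c p = t} : Finset β) = {p ∈ s | c p = t} \ {p ∈ b | c p = t} by grind,
          card_sdiff_of_subset (filter_subset_filter _ hb.1), hs, hb.2.2,
          Nat.add_sub_add_right]
    · intro b hb hb'
      simp only [mem_filter] at hb hb'
      rw [balancedEwensWeight, if_neg, zero_mul]
      intro h
      refine hb' ⟨hb.1.1, hb.1.2, fun t => ?_⟩
      have := hpos hb.1.2
      rw [h t (c a)]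
      omega
  · intro b hb
    simp only [mem_filter, mem_powerset] at hb
    have := card_le_card (filter_subset_filter (fun p => c p = c a) hb.1)
    rw [hs] at this
    have := hpos hb.2
    rw [mem_range]
    omega

end Colored

end BalancedEwens

/-- Normalization of the one-parameter (Ewens) limit of the balanced Chinese restaurant
process: the weights `(λ/j)^{#π} ∏_{b∈π} (#b/j)^{j−1}((#b/j − 1)!)^j` on `j`-balanced set
partitions of `{1,…,n} × {1,…,j}` sum to `(λ/j)^{↑n}(n!)^{j−1}`. -/
theorem balanced_ewens_normalization (n j : ℕ) (hn : 1 ≤ n) (hj : 1 ≤ j) (lam : ℝ) :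
    ∑ π ∈ (Finset.univ : Finset (Finpartition (Finset.univ : Finset (Fin n × Fin j)))).filter
        (fun π => IsBalanced π),
      (lam / j) ^ π.parts.card *
        ∏ b ∈ π.parts,
          ((b.card / j : ℕ) : ℝ) ^ (j - 1) * (Nat.factorial (b.card / j - 1) : ℝ) ^ j =
    risingFactorial (lam / j) n * (Nat.factorial n : ℝ) ^ (j - 1) := by
  have : Nonempty (Fin j) := ⟨⟨0, hj⟩⟩
  have key := sum_prod_balancedEwensWeight (Prod.snd : Fin n × Fin j → Fin j) (lam / j) n
    Finset.univ fun t => by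
      rw [Finset.card_filter, Fintype.sum_prod_type]
      simp
  rw [Fintype.card_fin] at key
  rw [← key, Finset.sum_filter]
  refine Finset.sum_congr (by congr!) fun π _ => ?_
  by_cases hπ : IsBalanced π
  · rw [if_pos hπ, Finset.pow_card_mul_prod]
    refine Finset.prod_congr rfl fun b hb => ?_
    rw [balancedEwensWeight, if_pos (hπ b hb), Fintype.card_fin]
  · rw [if_neg hπ]
    obtain ⟨b, hb, hb'⟩ : ∃ b ∈ π.parts, ¬ ∀ t t' : Fin j,
        (b.filter fun p => p.2 = t).card = (b.filter fun p => p.2 = t').card := by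
      simpa only [IsBalanced, not_forall, exists_prop] using hπ
    exact (Finset.prod_eq_zero hb (if_neg hb')).symm
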